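/- For all integers a ≥ 1, b ≥ 1 and m ≥ (a+b+1)·2^{a+b+3}, one has 2^{a+b+1}·p(m,a,b) ≥ C(m,a)·C(m−a,b). -/

import Mathlib

/-- `p(n,k,l) = max_{0 ≤ x ≤ n} C(x,k)·C(n-x,l)`. -/
def pVal (n k l : ℕ) : ℕ :=
  (Finset.range (n + 1)).sup fun x => Nat.choose x k * Nat.choose (n - x) l

theorem choose_mul_choose_sub_comm {n k l : ℕ} :
    n.choose k * (n - k).choose l = n.choose l * (n - l).choose k := by
  have h₁ := Nat.choose_mul (n := n) (Nat.le_add_right k l)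
  have h₂ := Nat.choose_mul (n := n) (Nat.le_add_left l k)
  rw [Nat.add_sub_cancel_left] at h₁
  rw [Nat.add_sub_cancel] at h₂
  rw [← h₁, ← h₂, Nat.choose_symm_add]

theorem choose_mul_choose_le_pVal {n x : ℕ} (hx : x ≤ n) (k l : ℕ) :
    x.choose k * (n - x).choose l ≤ pVal n k l :=
  Finset.le_sup (f := fun x => x.choose k * (n - x).choose l)
    (Finset.mem_range_succ_iff.2 hx)

/-- Splitting `{1, …, m}` into two parts and choosing `a` elements of the first and `b` of the
second amounts to choosing disjoint sets of sizes `a` and `b` and splitting the rest. -/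
theorem choose_mul_choose_mul_choose_sub (a b m y : ℕ) :
    m.choose (a + y) * ((a + y).choose a * (m - (a + y)).choose b) =
      m.choose a * (m - a).choose b * (m - a - b).choose y := by
  rw [← mul_assoc, Nat.choose_mul (Nat.le_add_right a y), Nat.add_sub_cancel_left,
    ← Nat.sub_sub, mul_assoc, choose_mul_choose_sub_comm, mul_assoc]

theorem choose_mul_choose_le_two_pow_mul_pVal (a b m : ℕ) (h : a + b ≤ m) :
    m.choose a * (m - a).choose b ≤ 2 ^ (a + b) * pVal m a b := by
  obtain ⟨n, rfl⟩ := Nat.exists_eq_add_of_le h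
  have hn : a + b + n - a - b = n := by omega
  set m := a + b + n
  refine Nat.le_of_mul_le_mul_right ?_ (pow_pos two_pos n)
  calc
    m.choose a * (m - a).choose b * 2 ^ n
        = ∑ y ∈ Finset.range (n + 1),
            m.choose (a + y) * ((a + y).choose a * (m - (a + y)).choose b) := by
      simp_rw [choose_mul_choose_mul_choose_sub, hn, ← Finset.mul_sum, Nat.sum_range_choose]
    _ ≤ ∑ y ∈ Finset.range (n + 1), m.choose (a + y) * pVal m a b := by
      refine Finset.sum_le_sum fun y hy => Nat.mul_le_mul_left _ ?_
      rw [Finset.mem_range] at hy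
      exact choose_mul_choose_le_pVal (by omega) a b
    _ = (∑ x ∈ Finset.Ico a (a + n + 1), m.choose x) * pVal m a b := by
      rw [← Finset.sum_mul, Finset.sum_Ico_eq_sum_range, add_assoc, Nat.add_sub_cancel_left]
    _ ≤ (∑ x ∈ Finset.range (m + 1), m.choose x) * pVal m a b := by
      gcongr
      intro x hx
      rw [Finset.mem_Ico] at hx
      rw [Finset.mem_range]
      omega
    _ = 2 ^ (a + b) * pVal m a b * 2 ^ n := by
      rw [Nat.sum_range_choose, pow_add]
      ring

/-- For all integers `a ≥ 1`, `b ≥ 1` and `m ≥ (a+b+1)·2^(a+b+3)`,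
one has `2^(a+b+1)·p(m,a,b) ≥ C(m,a)·C(m-a,b)`. -/
theorem stmt_18 (a b m : ℕ) (ha : 1 ≤ a) (hb : 1 ≤ b)
    (hm : (a + b + 1) * 2 ^ (a + b + 3) ≤ m) :
    Nat.choose m a * Nat.choose (m - a) b ≤ 2 ^ (a + b + 1) * pVal m a b := by
  have h : a + b ≤ m := by
    have := Nat.le_mul_of_pos_right (a + b + 1) (pow_pos two_pos (a + b + 3))
    omega
  exact (choose_mul_choose_le_two_pow_mul_pVal a b m h).trans
    (Nat.mul_le_mul_right _ (Nat.pow_le_pow_right two_pos (Nat.le_succ _)))
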